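/- Let n ≥ 4 and let G = C_{2n}(1, n) be the cubic circulant graph on 2n vertices with connection set {1, n}. Then the edge ideal I(G) satisfies reg(I(G)) ≤ k + 1 if n = 2k, or if n = 2k + 1 with k odd; and reg(I(G)) ≤ k + 2 if n = 2k + 1 with k even. -/

import Mathlib

/-- The faces of cardinality `m` of a simplicial complex, given as a finite
family of finite subsets of `Fin n`. -/
def cfaces {n : ℕ} (Δ : Finset (Finset (Fin n))) (m : ℕ) : Finset (Finset (Fin n)) :=
  Δ.filter (fun F => F.card = m)

/-- The coefficient of the face `G` in the simplicial boundary of the face `F`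
(with respect to the linear order on the vertices `Fin n`). -/
noncomputable def bcoeff (K : Type*) [Field K] {n : ℕ} (F G : Finset (Fin n)) : K :=
  ∑ v ∈ F, if F.erase v = G then (-1 : K) ^ (F.filter (fun w => w < v)).card else 0

/-- The simplicial boundary map from chains spanned by faces of cardinality `m+1`
to chains spanned by faces of cardinality `m` (so the augmentation map
corresponds to `m = 0`). -/
noncomputable def boundaryMap (K : Type*) [Field K] {n : ℕ}
    (Δ : Finset (Finset (Fin n))) (m : ℕ) :
    ({F // F ∈ cfaces Δ (m + 1)} → K) →ₗ[K] ({G // G ∈ cfaces Δ m} → K) :=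
  LinearMap.pi fun G => ∑ F : {F // F ∈ cfaces Δ (m + 1)}, bcoeff K F.1 G.1 • LinearMap.proj F

/-- The dimension over `K` of the `i`-th reduced simplicial homology of the
simplicial complex `Δ` (using the augmented chain complex, so that
`i = -1` is allowed). -/
noncomputable def reducedHomologyRank (K : Type*) [Field K] {n : ℕ}
    (Δ : Finset (Finset (Fin n))) (i : ℤ) : ℕ :=
  if i = -1 then
    Module.finrank K (({F // F ∈ cfaces Δ 0} → K) ⧸ LinearMap.range (boundaryMap K Δ 0))
  else if 0 ≤ i then
    Module.finrank K
      (↥(LinearMap.ker (boundaryMap K Δ i.toNat)) ⧸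
        Submodule.comap (LinearMap.ker (boundaryMap K Δ i.toNat)).subtype
          (LinearMap.range (boundaryMap K Δ (i.toNat + 1))))
  else 0

/-- The graded Betti numbers `β_{i,j}` of the Stanley–Reisner ideal of the
simplicial complex `Δ` over the field `K`, defined via Hochster's formula:
`β_{i,j} = ∑_{|W| = j} dim_K H̃_{j-i-2}(Δ_W; K)`. -/
noncomputable def bettiNumber (K : Type*) [Field K] {n : ℕ}
    (Δ : Finset (Finset (Fin n))) (i j : ℕ) : ℕ :=
  ∑ W ∈ Finset.powersetCard j (Finset.univ : Finset (Fin n)),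
    reducedHomologyRank K (Δ.filter (fun F => F ⊆ W)) ((j : ℤ) - (i : ℤ) - 2)

/-- The Castelnuovo–Mumford regularity `reg(I) = max { j - i | β_{i,j}(I) ≠ 0 }`
of the Stanley–Reisner ideal of `Δ` over `K`. -/
noncomputable def regSR (K : Type*) [Field K] {n : ℕ} (Δ : Finset (Finset (Fin n))) : ℕ :=
  sSup {d : ℕ | ∃ i j : ℕ, bettiNumber K Δ i j ≠ 0 ∧ (j : ℤ) - (i : ℤ) = d}

/-- The projective dimension `pd(I) = max { i | β_{i,j}(I) ≠ 0 for some j }`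
of the Stanley–Reisner ideal of `Δ` over `K`. -/
noncomputable def pdSR (K : Type*) [Field K] {n : ℕ} (Δ : Finset (Finset (Fin n))) : ℕ :=
  sSup {i : ℕ | ∃ j : ℕ, bettiNumber K Δ i j ≠ 0}

/-- The reduced Euler characteristic `χ̃(Δ) = ∑_{F ∈ Δ} (-1)^{|F| - 1}`
of a simplicial complex `Δ` (the alternating sum of the `f`-vector). -/
def eulerCharSR {n : ℕ} (Δ : Finset (Finset (Fin n))) : ℤ :=
  ∑ F ∈ Δ, (-1 : ℤ) ^ (F.card + 1)

/-- The circulant graph `C_n(S)`: the graph on the vertex set `ZMod n`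
(identified with `{x_1, …, x_n}`) in which `x` and `y` are adjacent if and only
if they differ by `±s (mod n)` for some `s ∈ S`. -/
def circulant (n : ℕ) (S : Set ℕ) : SimpleGraph (ZMod n) :=
  SimpleGraph.fromRel (fun x y => ∃ s ∈ S, y - x = (s : ZMod n))

/-- A graph is chordal if it has no induced cycle of length `m ≥ 4`.  Here an
induced `m`-cycle is an injection of the cycle `C_m = C_m(1)` whose image
induces exactly the cycle's adjacency. -/
def IsChordal {V : Type*} (G : SimpleGraph V) : Prop :=
  ∀ m : ℕ, 4 ≤ m → ¬ ∃ f : ZMod m → V, Function.Injective f ∧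
    ∀ a b : ZMod m, G.Adj (f a) (f b) ↔ (circulant m {1}).Adj a b

/-- A graph is claw-free if it has no induced subgraph isomorphic to the claw
`K_{1,3}`, i.e. there is no vertex adjacent to three pairwise non-adjacent
vertices. -/
def ClawFree {V : Type*} (G : SimpleGraph V) : Prop :=
  ¬ ∃ c x y z : V, x ≠ y ∧ x ≠ z ∧ y ≠ z ∧
    G.Adj c x ∧ G.Adj c y ∧ G.Adj c z ∧ ¬ G.Adj x y ∧ ¬ G.Adj x z ∧ ¬ G.Adj y z

open Classical in
/-- The independence complex `Ind(G)` of a finite simple graph `G`, recorded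
as a simplicial complex on `Fin (card V)` via a fixed identification of the
vertices with `Fin (card V)`.  It is the Stanley–Reisner complex of the edge
ideal `I(G)`. -/
noncomputable def indComplex {V : Type*} [Fintype V] (G : SimpleGraph V) :
    Finset (Finset (Fin (Fintype.card V))) :=
  Finset.univ.filter (fun F : Finset (Fin (Fintype.card V)) =>
    ∀ u ∈ F, ∀ v ∈ F,
      ¬ G.Adj ((Fintype.equivFin V).symm u) ((Fintype.equivFin V).symm v))

/-- The Castelnuovo–Mumford regularity `reg(I(G))` of the edge ideal of the
finite simple graph `G` over the field `K`, computed (via Hochster's formula)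
from the independence complex of `G`. -/
noncomputable def regEdgeIdeal (K : Type*) [Field K] {V : Type*} [Fintype V]
    (G : SimpleGraph V) : ℕ :=
  regSR K (indComplex G)

/-- The projective dimension `pd(I(G))` of the edge ideal of the finite simple
graph `G` over the field `K`, computed (via Hochster's formula) from the
independence complex of `G`. -/
noncomputable def pdEdgeIdeal (K : Type*) [Field K] {V : Type*} [Fintype V]
    (G : SimpleGraph V) : ℕ :=
  pdSR K (indComplex G)

/-- The sign with which the vertex `v` enters the boundary of `insert v G`. -/
def vertexSign (K : Type*) [Field K] {N : ℕ} (v : Fin N) (G : Finset (Fin N)) : K :=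
  (-1) ^ (G.filter (fun w => w < v)).card

lemma vertexSign_mul_self (K : Type*) [Field K] {N : ℕ} (v : Fin N) (G : Finset (Fin N)) :
    vertexSign K v G * vertexSign K v G = 1 := by
  rw [vertexSign, ← mul_pow]
  simp

lemma vertexSign_insert_mul (K : Type*) [Field K] {N : ℕ} {v x : Fin N} {G : Finset (Fin N)}
    (hvx : v ≠ x) (hv : v ∉ G) (hx : x ∉ G) :
    vertexSign K v (insert x G) * vertexSign K x (insert v G) =
      -(vertexSign K x G * vertexSign K v G) := by
  unfold vertexSign
  rw [Finset.filter_insert, Finset.filter_insert]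
  rcases lt_or_gt_of_ne hvx with h | h
  · rw [if_neg (not_lt.mpr h.le), if_pos h, Finset.card_insert_of_notMem (by simp [hv])]
    ring
  · rw [if_pos h, if_neg (not_lt.mpr h.le), Finset.card_insert_of_notMem (by simp [hx])]
    ring

/-- The simplicial boundary on chains of the full simplex, viewed as functions on all faces. -/
def chainBoundary {K : Type*} [Field K] {N : ℕ} (f : Finset (Fin N) → K) (G : Finset (Fin N)) :
    K :=
  ∑ v ∈ Gᶜ, vertexSign K v G * f (insert v G)

/-- Joining a chain with the vertex `x`. -/
def joinVertex {K : Type*} [Field K] {N : ℕ} (x : Fin N) (g : Finset (Fin N) → K)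
    (F : Finset (Fin N)) : K :=
  if x ∈ F then vertexSign K x (F.erase x) * g (F.erase x) else 0

lemma chainBoundary_add {K : Type*} [Field K] {N : ℕ} (f g : Finset (Fin N) → K)
    (G : Finset (Fin N)) :
    chainBoundary (fun F => f F + g F) G = chainBoundary f G + chainBoundary g G := by
  simp [chainBoundary, mul_add, Finset.sum_add_distrib]

lemma chainBoundary_sub {K : Type*} [Field K] {N : ℕ} (f g : Finset (Fin N) → K)
    (G : Finset (Fin N)) :
    chainBoundary (fun F => f F - g F) G = chainBoundary f G - chainBoundary g G := by
  simp [chainBoundary, mul_sub, Finset.sum_sub_distrib]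

/-- Joining with a vertex is a contracting homotopy of the full simplex. -/
lemma chainBoundary_joinVertex {K : Type*} [Field K] {N : ℕ} (x : Fin N)
    (g : Finset (Fin N) → K) (G : Finset (Fin N)) :
    chainBoundary (joinVertex x g) G + joinVertex x (chainBoundary g) G = g G := by
  by_cases hx : x ∈ G
  · obtain ⟨G', hx', rfl⟩ : ∃ G', x ∉ G' ∧ G = insert x G' :=
      ⟨G.erase x, Finset.notMem_erase x G, (Finset.insert_erase hx).symm⟩
    have hc : G'ᶜ = insert x (insert x G')ᶜ := by
      ext u
      by_cases hu : u = x
      · subst hu; simp [hx']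
      · simp [hu]
    have hj : joinVertex x (chainBoundary g) (insert x G') =
        vertexSign K x G' * (vertexSign K x G' * g (insert x G') +
          ∑ v ∈ (insert x G')ᶜ, vertexSign K v G' * g (insert v G')) := by
      rw [joinVertex, if_pos hx, Finset.erase_insert hx', chainBoundary, hc,
        Finset.sum_insert (by simp)]
    have hb : chainBoundary (joinVertex x g) (insert x G') =
        -(vertexSign K x G' * ∑ v ∈ (insert x G')ᶜ, vertexSign K v G' * g (insert v G')) := by
      rw [chainBoundary, Finset.mul_sum, ← Finset.sum_neg_distrib]
      refine Finset.sum_congr rfl fun v hv => ?_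
      have hv' : v ≠ x ∧ v ∉ G' := by simpa using hv
      have he : (insert v (insert x G')).erase x = insert v G' := by
        rw [Finset.insert_comm, Finset.erase_insert]
        simp [hx', hv'.1.symm]
      rw [joinVertex, if_pos (by simp), he, ← mul_assoc,
        vertexSign_insert_mul K hv'.1 hv'.2 hx']
      ring
    rw [hb, hj]
    linear_combination g (insert x G') * vertexSign_mul_self K x G'
  · have hb : chainBoundary (joinVertex x g) G = g G := by
      rw [chainBoundary, Finset.sum_eq_single x]
      · rw [joinVertex, if_pos (by simp), Finset.erase_insert hx, ← mul_assoc,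
          vertexSign_mul_self, one_mul]
      · intro v _ hv
        rw [joinVertex, if_neg (by simp [hx, hv.symm]), mul_zero]
      · intro h
        simp [hx] at h
    rw [hb, joinVertex, if_neg hx, add_zero]

/-- `F` is an independent set of `H` of cardinality `c` contained in `W`. -/
def IsIndepFace {N : ℕ} (H : SimpleGraph (Fin N)) (W : Finset (Fin N)) (c : ℕ)
    (F : Finset (Fin N)) : Prop :=
  F ⊆ W ∧ (∀ u ∈ F, ∀ v ∈ F, ¬ H.Adj u v) ∧ F.card = c

/-- The independence complex of `H` induced on `W` has no reduced homology on faces of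
cardinality `c`, i.e. in degree `c - 1`. -/
def IndepAcyclic (K : Type*) [Field K] {N : ℕ} (H : SimpleGraph (Fin N)) (W : Finset (Fin N))
    (c : ℕ) : Prop :=
  ∀ f : Finset (Fin N) → K, (∀ F, f F ≠ 0 → IsIndepFace H W c F) →
    (∀ G, chainBoundary f G = 0) →
    ∃ g : Finset (Fin N) → K, (∀ F, g F ≠ 0 → IsIndepFace H W (c + 1) F) ∧
      ∀ G, chainBoundary g G = f G

/-- The vertices of `W` that are neither equal nor adjacent to `x`. -/
noncomputable def nonNeighbors {N : ℕ} (H : SimpleGraph (Fin N)) (W : Finset (Fin N))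
    (x : Fin N) : Finset (Fin N) :=
  open Classical in W.filter (fun w => w ≠ x ∧ ¬ H.Adj x w)

/-- The part of a cycle supported on the link of `x` is a cycle, and minus the boundary of the
part supported away from `x`. -/
lemma cycle_decomposition {K : Type*} [Field K] {N : ℕ} (H : SimpleGraph (Fin N))
    (W : Finset (Fin N)) (c : ℕ) (x : Fin N) (f : Finset (Fin N) → K)
    (hf : ∀ F, f F ≠ 0 → IsIndepFace H W (c + 1) F) (hcyc : ∀ G, chainBoundary f G = 0) :
    ∃ a b : Finset (Fin N) → K, (∀ F, f F = joinVertex x a F + b F) ∧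
      (∀ F, a F ≠ 0 → IsIndepFace H (nonNeighbors H W x) c F) ∧
      (∀ F, b F ≠ 0 → IsIndepFace H (W.erase x) (c + 1) F) ∧
      (∀ G, chainBoundary a G = 0) ∧ (∀ G, chainBoundary b G = - a G) := by
  set a : Finset (Fin N) → K := fun G => if x ∈ G then 0 else vertexSign K x G * f (insert x G)
    with ha
  set b : Finset (Fin N) → K := fun G => if x ∈ G then 0 else f G with hb
  have hab : ∀ F, f F = joinVertex x a F + b F := by
    intro F
    by_cases hx : x ∈ F
    · simp only [joinVertex, ha, hb, if_pos hx, Finset.notMem_erase, if_false,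
        Finset.insert_erase hx, add_zero]
      rw [← mul_assoc, vertexSign_mul_self, one_mul]
    · simp [joinVertex, hb, hx]
  have key : ∀ G, a G - joinVertex x (chainBoundary a) G + chainBoundary b G = 0 := by
    intro G
    have h1 := hcyc G
    rw [show f = fun F => joinVertex x a F + b F from funext hab, chainBoundary_add] at h1
    have h2 := chainBoundary_joinVertex x a G
    linear_combination h1 - h2
  have hoff : ∀ (h : Finset (Fin N) → K), (∀ G, x ∈ G → h G = 0) →
      ∀ G, x ∈ G → chainBoundary h G = 0 := by
    intro h hh G hG
    exact Finset.sum_eq_zero fun v _ => by rw [hh _ (Finset.mem_insert_of_mem hG), mul_zero]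
  have ha0 : ∀ G, x ∈ G → a G = 0 := fun G hG => by simp [ha, hG]
  have hb0 : ∀ G, x ∈ G → b G = 0 := fun G hG => by simp [hb, hG]
  have hda : ∀ G, chainBoundary a G = 0 := by
    intro G
    by_cases hx : x ∈ G
    · exact hoff a ha0 G hx
    · have h := key (insert x G)
      rw [ha0 _ (by simp), hoff b hb0 _ (by simp), joinVertex, if_pos (by simp),
        Finset.erase_insert hx] at h
      have h2 := vertexSign_mul_self K x G
      linear_combination (-vertexSign K x G) * h - chainBoundary a G * h2
  refine ⟨a, b, hab, ?_, ?_, hda, ?_⟩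
  · intro F hF
    have hx : x ∉ F := fun h => hF (ha0 F h)
    obtain ⟨h1, h2, h3⟩ := hf (insert x F) (by
      intro h
      exact hF (by simp [ha, h]))
    refine ⟨fun u hu => ?_, fun u hu v hv => h2 u (by simp [hu]) v (by simp [hv]), ?_⟩
    · simp only [nonNeighbors, Finset.mem_filter]
      exact ⟨h1 (by simp [hu]), fun h => hx (h ▸ hu), h2 x (by simp) u (by simp [hu])⟩
    · rw [Finset.card_insert_of_notMem hx] at h3
      omega
  · intro F hF
    have hx : x ∉ F := fun h => hF (hb0 F h)
    obtain ⟨h1, h2, h3⟩ := hf F (by simpa [hb, hx] using hF)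
    exact ⟨fun u hu => Finset.mem_erase.mpr ⟨fun h => hx (h ▸ hu), h1 hu⟩, h2, h3⟩
  · intro G
    have h := key G
    have : joinVertex x (chainBoundary a) G = 0 := by simp [joinVertex, hda]
    linear_combination h + this

lemma isIndepFace_mono {N : ℕ} {H : SimpleGraph (Fin N)} {W W' : Finset (Fin N)} (h : W ⊆ W')
    {c : ℕ} {F : Finset (Fin N)} (hF : IsIndepFace H W c F) : IsIndepFace H W' c F :=
  ⟨hF.1.trans h, hF.2⟩

lemma joinVertex_support {K : Type*} [Field K] {N : ℕ} {H : SimpleGraph (Fin N)}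
    {W : Finset (Fin N)} {c : ℕ} {x : Fin N} (hx : x ∈ W) {g : Finset (Fin N) → K}
    (hg : ∀ F, g F ≠ 0 → IsIndepFace H (nonNeighbors H W x) c F) (F : Finset (Fin N))
    (hF : joinVertex x g F ≠ 0) : IsIndepFace H W (c + 1) F := by
  unfold joinVertex at hF
  split_ifs at hF with hxF
  · obtain ⟨h1, h2, h3⟩ := hg _ (right_ne_zero_of_mul hF)
    simp only [nonNeighbors, Finset.subset_iff, Finset.mem_filter] at h1
    refine ⟨fun u hu => ?_, fun u hu v hv => ?_, ?_⟩
    · by_cases hux : u = x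
      · rwa [hux]
      · exact (h1 (Finset.mem_erase.mpr ⟨hux, hu⟩)).1
    · by_cases hux : u = x
      · by_cases hvx : v = x
        · rw [hux, hvx]
          exact H.irrefl
        · rw [hux]
          exact (h1 (Finset.mem_erase.mpr ⟨hvx, hv⟩)).2.2
      · by_cases hvx : v = x
        · rw [hvx]
          exact fun h => (h1 (Finset.mem_erase.mpr ⟨hux, hu⟩)).2.2 h.symm
        · exact h2 u (Finset.mem_erase.mpr ⟨hux, hu⟩) v (Finset.mem_erase.mpr ⟨hvx, hv⟩)
    · rw [← Finset.card_erase_add_one hxF, h3]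
  · exact absurd rfl hF

/-- Vanishing of homology for the deletion and the link of `x` implies vanishing. -/
lemma IndepAcyclic.of_erase_of_nonNeighbors {K : Type*} [Field K] {N : ℕ}
    {H : SimpleGraph (Fin N)} {W : Finset (Fin N)} {c : ℕ} {x : Fin N} (hx : x ∈ W)
    (h1 : IndepAcyclic K H (W.erase x) (c + 1)) (h2 : IndepAcyclic K H (nonNeighbors H W x) c) :
    IndepAcyclic K H W (c + 1) := by
  intro f hf hcyc
  obtain ⟨a, b, hab, hasupp, hbsupp, hda, hdb⟩ := cycle_decomposition H W c x f hf hcyc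
  obtain ⟨p, hp, hdp⟩ := h2 a hasupp hda
  obtain ⟨q, hq, hdq⟩ := h1 (fun F => b F + p F) (by
      intro F hF
      by_cases hbF : b F = 0
      · refine isIndepFace_mono ?_ (hp F (by intro h; simp [h, hbF] at hF))
        intro u hu
        simp only [nonNeighbors, Finset.mem_filter] at hu
        exact Finset.mem_erase.mpr ⟨hu.2.1, hu.1⟩
      · exact hbsupp F hbF) (by
      intro G
      rw [chainBoundary_add, hdb, hdp]
      ring)
  refine ⟨fun F => q F - joinVertex x p F, fun F hF => ?_, fun G => ?_⟩
  · by_cases hqF : q F = 0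
    · exact joinVertex_support hx hp F (by intro h; simp [h, hqF] at hF)
    · exact isIndepFace_mono (Finset.erase_subset x W) (hq F hqF)
  · have h := chainBoundary_joinVertex x p G
    rw [show chainBoundary p = a from funext hdp] at h
    rw [chainBoundary_sub, hdq, hab G]
    linear_combination -h

/-- The independence complex of a graph with an isolated vertex is a cone. -/
lemma IndepAcyclic.of_isolated {K : Type*} [Field K] {N : ℕ} {H : SimpleGraph (Fin N)}
    {W : Finset (Fin N)} {x : Fin N} (hx : x ∈ W) (hiso : ∀ w ∈ W, ¬ H.Adj x w) (c : ℕ) :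
    IndepAcyclic K H W (c + 1) := by
  intro f hf hcyc
  obtain ⟨a, b, hab, -, hbsupp, -, hdb⟩ := cycle_decomposition H W c x f hf hcyc
  refine ⟨joinVertex x b, joinVertex_support hx fun F hF => ?_, fun G => ?_⟩
  · refine isIndepFace_mono (fun u hu => ?_) (hbsupp F hF)
    rw [Finset.mem_erase] at hu
    simp only [nonNeighbors, Finset.mem_filter]
    exact ⟨hu.2, hu.1, hiso u hu.2⟩
  · have h := chainBoundary_joinVertex x b G
    have h2 : joinVertex x (chainBoundary b) G = - joinVertex x a G := by
      simp only [joinVertex, hdb]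
      split_ifs <;> ring
    rw [h2] at h
    rw [hab G]
    linear_combination h

/-- All subgraphs of `H` induced on vertices whose label satisfies `S` have independence
complexes without homology in degrees at least `r`. -/
def HomologyBound (K : Type*) [Field K] {N : ℕ} (H : SimpleGraph (Fin N)) (φ : Fin N → ℕ)
    (S : ℕ → Prop) (r : ℕ) : Prop :=
  ∀ W : Finset (Fin N), (∀ w ∈ W, S (φ w)) → ∀ c, r ≤ c → IndepAcyclic K H W (c + 1)

/-- Adjacency of labels in the Möbius ladder `C_{2n}(1,n)` with vertices `0, …, 2n-1`. -/
def LadderAdj (n u v : ℕ) : Prop :=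
  v = u + 1 ∨ u = v + 1 ∨ v = u + n ∨ u = v + n ∨ (u = 0 ∧ v + 1 = 2 * n) ∨
    (v = 0 ∧ u + 1 = 2 * n)

section Labelled

variable {K : Type*} [Field K] {N n : ℕ} {H : SimpleGraph (Fin N)} {φ : Fin N → ℕ}

lemma HomologyBound.mono {S S' : ℕ → Prop} {r r' : ℕ} (h : HomologyBound K H φ S r)
    (hS : ∀ u, u < 2 * n → S' u → S u) (hφ : ∀ w, φ w < 2 * n) (hr : r ≤ r') :
    HomologyBound K H φ S' r' :=
  fun W hW c hc => h W (fun w hw => hS _ (hφ w) (hW w hw)) c (hr.trans hc)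

lemma HomologyBound.split (hinj : Function.Injective φ) (hφ : ∀ w, φ w < 2 * n)
    (hadj : ∀ v w, LadderAdj n (φ v) (φ w) → H.Adj v w) (x : ℕ) {S S₁ S₂ : ℕ → Prop} {r : ℕ}
    (h₁ : HomologyBound K H φ S₁ (r + 1)) (h₂ : HomologyBound K H φ S₂ r)
    (hS₁ : ∀ u, u < 2 * n → S u → u ≠ x → S₁ u)
    (hS₂ : ∀ u, u < 2 * n → S u → u ≠ x → ¬ LadderAdj n x u → S₂ u) :
    HomologyBound K H φ S (r + 1) := by
  intro W hW c hc
  by_cases hx : ∃ w ∈ W, φ w = x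
  · obtain ⟨w, hw, rfl⟩ := hx
    obtain ⟨c, rfl⟩ : ∃ c', c = c' + 1 := ⟨c - 1, by omega⟩
    refine IndepAcyclic.of_erase_of_nonNeighbors hw (h₁ _ (fun v hv => ?_) _ hc)
      (h₂ _ (fun v hv => ?_) c (by omega))
    · rw [Finset.mem_erase] at hv
      exact hS₁ _ (hφ v) (hW v hv.2) fun h => hv.1 (hinj h)
    · simp only [nonNeighbors, Finset.mem_filter] at hv
      exact hS₂ _ (hφ v) (hW v hv.1) (fun h => hv.2.1 (hinj h)) fun h => hv.2.2 (hadj _ _ h)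
  · push Not at hx
    exact h₁ W (fun v hv => hS₁ _ (hφ v) (hW v hv) (hx v hv)) c hc

lemma HomologyBound.isolated (hφ : ∀ w, φ w < 2 * n)
    (hadj : ∀ v w, H.Adj v w → LadderAdj n (φ v) (φ w)) (x : ℕ) {S S₁ : ℕ → Prop} {r : ℕ}
    (h₁ : HomologyBound K H φ S₁ r) (hS₁ : ∀ u, u < 2 * n → S u → u ≠ x → S₁ u)
    (hiso : ∀ u, u < 2 * n → S u → ¬ LadderAdj n x u) :
    HomologyBound K H φ S r := by
  intro W hW c hc
  by_cases hx : ∃ w ∈ W, φ w = x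
  · obtain ⟨w, hw, rfl⟩ := hx
    exact IndepAcyclic.of_isolated hw (fun v hv h => hiso _ (hφ v) (hW v hv) (hadj _ _ h)) c
  · push Not at hx
    exact h₁ W (fun v hv => hS₁ _ (hφ v) (hW v hv) (hx v hv)) c hc

lemma HomologyBound.of_false (r : ℕ) : HomologyBound K H φ (fun _ => False) r := by
  intro W hW c _ f hf _
  have hW' : W = ∅ := Finset.eq_empty_of_forall_notMem hW
  refine ⟨fun _ => 0, fun F hF => absurd rfl hF, fun G => ?_⟩
  by_contra hG
  obtain ⟨h1, -, h3⟩ := hf G (fun h => hG (by simp [chainBoundary, h]))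
  rw [hW', Finset.subset_empty] at h1
  simp [h1] at h3

/-- A ladder whose full columns `{u, u + n}` are those with `p < u ≤ q`, with the extra vertex
`p + s * n` on the left and the vertices `q < u < n` on the right. -/
def Strip (n q p s u : ℕ) : Prop :=
  u = p + s * n ∨ (p < u ∧ u < n) ∨ (p + n < u ∧ u ≤ q + n)

lemma homologyBound_strip_step (hinj : Function.Injective φ) (hφ : ∀ w, φ w < 2 * n)
    (hadj : ∀ v w, H.Adj v w ↔ LadderAdj n (φ v) (φ w)) {q p s r : ℕ} (hp : 1 ≤ p)
    (hpq : p + 1 ≤ q) (hq : q < n) (hs : s < 2)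
    (h₁ : HomologyBound K H φ (Strip n q (p + 1) (1 - s)) (r + 1))
    (h₂ : HomologyBound K H φ (Strip n q (p + 2) (1 - s)) r) :
    HomologyBound K H φ (Strip n q p s) (r + 1) := by
  have h₃ : HomologyBound K H φ (fun u => Strip n q p s u ∧ u ≠ p + 1 + s * n) (r + 1) := by
    refine HomologyBound.isolated hφ (fun v w => (hadj v w).1) (p + s * n) h₁ ?_ ?_
    · intro u hu
      interval_cases s <;> simp only [Strip] <;> omega
    · intro u hu
      interval_cases s <;> simp only [Strip, LadderAdj] <;> omega
  refine HomologyBound.split hinj hφ (fun v w => (hadj v w).2) (p + 1 + s * n) h₃ h₂ ?_ ?_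
  · exact fun u _ h h' => ⟨h, h'⟩
  · intro u hu
    interval_cases s <;> simp only [Strip, LadderAdj] <;> omega

lemma homologyBound_strip_one_end (hinj : Function.Injective φ) (hφ : ∀ w, φ w < 2 * n)
    (hadj : ∀ v w, H.Adj v w ↔ LadderAdj n (φ v) (φ w)) (hn : 4 ≤ n) :
    ∀ t p s : ℕ, 1 ≤ p → p + t = n → s < 2 →
      HomologyBound K H φ (Strip n (n - 1) p s) (t / 2) := by
  intro t
  induction t using Nat.strong_induction_on with
  | _ t ih =>
    intro p s hp hpt hs
    by_cases ht : t < 2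
    · refine HomologyBound.isolated hφ (fun v w => (hadj v w).1) (p + s * n)
        (HomologyBound.of_false _) ?_ ?_ <;>
      · intro u hu
        interval_cases s <;> simp only [Strip, LadderAdj] <;> omega
    · obtain ⟨t, rfl⟩ : ∃ t', t = t' + 2 := ⟨t - 2, by omega⟩
      have h₁ := ih (t + 1) (by omega) (p + 1) (1 - s) (by omega) (by omega) (by omega)
      have h₂ := ih t (by omega) (p + 2) (1 - s) (by omega) (by omega) (by omega)
      rw [show (t + 2) / 2 = t / 2 + 1 by omega]
      exact homologyBound_strip_step hinj hφ hadj hp (by omega) (by omega) hs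
        (h₁.mono (n := n) (fun _ _ h => h) hφ (by omega)) h₂

/-- The homology bound for a strip with an extra vertex at both ends. -/
def stripBound (t s : ℕ) : ℕ :=
  t / 2 + if t % 2 = 1 ∧ (t / 2 + s) % 2 = 0 then 1 else 0

lemma homologyBound_strip_two_ends (hinj : Function.Injective φ) (hφ : ∀ w, φ w < 2 * n)
    (hadj : ∀ v w, H.Adj v w ↔ LadderAdj n (φ v) (φ w)) (hn : 4 ≤ n) :
    ∀ t p s : ℕ, 1 ≤ p → p + t + 1 = n → s < 2 →
      HomologyBound K H φ (Strip n (n - 2) p s) (stripBound t s) := by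
  intro t
  induction t using Nat.strong_induction_on with
  | _ t ih =>
    intro p s hp hpt hs
    by_cases ht : t < 2
    · by_cases hts : t = 1 ∧ s = 0
      · obtain ⟨rfl, rfl⟩ := hts
        have h₀ : HomologyBound K H φ (fun u => u = p + 1) 0 := by
          refine HomologyBound.isolated hφ (fun v w => (hadj v w).1) (p + 1)
            (HomologyBound.of_false _) ?_ ?_ <;>
          · intro u hu
            try simp only [LadderAdj]
            omega
        refine HomologyBound.split hinj hφ (fun v w => (hadj v w).2) p
          (h₀.mono (n := n) (S' := fun u => u = p + 1) (fun _ _ h => h) hφ zero_le_one) h₀ ?_ ?_ <;>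
        · intro u hu
          simp only [Strip, LadderAdj]
          omega
      · have h₀ : HomologyBound K H φ (fun u => u = n - 1 ∧ t = 1) (stripBound t s) := by
          refine HomologyBound.isolated hφ (fun v w => (hadj v w).1) (n - 1)
            (HomologyBound.of_false _) ?_ ?_ <;>
          · intro u hu
            try simp only [LadderAdj]
            omega
        refine HomologyBound.isolated hφ (fun v w => (hadj v w).1) (p + s * n) h₀ ?_ ?_ <;>
        · intro u hu
          interval_cases s <;> simp only [Strip, LadderAdj] <;> omega
    · obtain ⟨t, rfl⟩ : ∃ t', t = t' + 2 := ⟨t - 2, by omega⟩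
      have h₁ := ih (t + 1) (by omega) (p + 1) (1 - s) (by omega) (by omega) (by omega)
      have h₂ := ih t (by omega) (p + 2) (1 - s) (by omega) (by omega) (by omega)
      have hle : stripBound (t + 1) (1 - s) ≤ stripBound t (1 - s) + 1 := by
        unfold stripBound
        split_ifs <;> omega
      have heq : stripBound (t + 2) s = stripBound t (1 - s) + 1 := by
        unfold stripBound
        split_ifs <;> omega
      rw [heq]
      exact homologyBound_strip_step hinj hφ hadj hp (by omega) (by omega) hs
        (h₁.mono (n := n) (fun _ _ h => h) hφ hle) h₂

/-- The homology bound for the whole Möbius ladder, given a labelling `φ` and the labelling `ψ`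
obtained by rotating it by `n`. -/
lemma homologyBound_ladder {ψ : Fin N → ℕ} (hinj : Function.Injective φ)
    (hφ : ∀ w, φ w < 2 * n) (hadj : ∀ v w, H.Adj v w ↔ LadderAdj n (φ v) (φ w))
    (hψ : ∀ w, (φ w < n ∧ ψ w = φ w + n) ∨ (n ≤ φ w ∧ φ w = ψ w + n)) (hn : 4 ≤ n) {r : ℕ}
    (hr₁ : n / 2 ≤ r + 1) (hr₂ : stripBound (n - 2) 1 ≤ r) :
    HomologyBound K H φ (fun _ => True) (r + 1) := by
  have hψlt : ∀ w, ψ w < 2 * n := fun w => by have := hψ w; have := hφ w; omega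
  have hψinj : Function.Injective ψ := fun v w h => hinj (by
    have := hψ v; have := hψ w; have := hφ v; have := hφ w; omega)
  have hψadj : ∀ v w, H.Adj v w ↔ LadderAdj n (ψ v) (ψ w) := fun v w => by
    rw [hadj]
    have := hψ v; have := hψ w; have := hφ v; have := hφ w
    simp only [LadderAdj]
    omega
  have hφ2 : HomologyBound K H φ (Strip n (n - 2) 1 1) r :=
    (homologyBound_strip_two_ends hinj hφ hadj hn (n - 2) 1 1 le_rfl (by omega) (by omega)).mono
      (n := n) (fun _ _ h => h) hφ hr₂
  have hψ2 : HomologyBound K H ψ (Strip n (n - 2) 1 1) r :=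
    (homologyBound_strip_two_ends hψinj hψlt hψadj hn (n - 2) 1 1 le_rfl (by omega)
      (by omega)).mono (n := n) (fun _ _ h => h) hψlt hr₂
  have hladder : HomologyBound K H φ (fun u => 0 < u ∧ (u < n ∨ n < u)) (r + 1) := by
    have h₁ := homologyBound_strip_one_end (K := K) hinj hφ hadj hn (n - 1) 1 1 le_rfl
      (by omega) (by omega)
    have h₂ := homologyBound_strip_one_end (K := K) hinj hφ hadj hn (n - 2) 2 1 (by omega)
      (by omega) (by omega)
    refine HomologyBound.split hinj hφ (fun v w => (hadj v w).2) 1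
      (h₁.mono (n := n) (fun _ _ h => h) hφ (by omega))
      (h₂.mono (n := n) (fun _ _ h => h) hφ (by omega)) ?_ ?_ <;>
    · intro u hu
      try simp only [Strip, LadderAdj]
      omega
  have hφ1 : HomologyBound K H ψ (fun u => 0 < u ∧ (u < n ∨ n < u)) (r + 1) := by
    intro W hW
    refine hladder W fun w hw => ?_
    have h := hW w hw
    have := hφ w
    have := hψ w
    dsimp only at h ⊢
    omega
  have hψ1 : HomologyBound K H ψ (fun u => u ≠ n) (r + 1) := by
    refine HomologyBound.split hψinj hψlt (fun v w => (hψadj v w).2) 0 hφ1 hψ2 ?_ ?_ <;>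
    · intro u hu
      try simp only [Strip, LadderAdj, true_and]
      omega
  have hφ0 : HomologyBound K H φ (fun u => u ≠ 0) (r + 1) := by
    intro W hW
    refine hψ1 W fun w hw => ?_
    have h := hW w hw
    have := hφ w
    have := hψ w
    dsimp only at h ⊢
    omega
  refine HomologyBound.split hinj hφ (fun v w => (hadj v w).2) 0 hφ0 hφ2 ?_ ?_ <;>
  · intro u hu
    try simp only [Strip, LadderAdj, true_and]
    omega

end Labelled

lemma sum_bcoeff_mul (K : Type*) [Field K] {N : ℕ} (f : Finset (Fin N) → K)
    (G : Finset (Fin N)) : ∑ F, bcoeff K F G * f F = chainBoundary f G := by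
  have h : ∀ F : Finset (Fin N), bcoeff K F G * f F =
      ∑ v, if v ∈ Gᶜ ∧ F = insert v G then vertexSign K v G * f (insert v G) else 0 := by
    intro F
    rw [bcoeff, Finset.sum_mul, ← Finset.sum_subset (Finset.subset_univ F)]
    · refine Finset.sum_congr rfl fun v hv => ?_
      by_cases hF : F.erase v = G
      · have hvG : v ∉ G := hF ▸ Finset.notMem_erase v F
        have hFi : F = insert v G := by rw [← hF, Finset.insert_erase hv]
        have hfil : F.filter (fun w => w < v) = G.filter (fun w => w < v) := by
          rw [hFi, Finset.filter_insert, if_neg (lt_irrefl v)]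
        rw [if_pos hF, if_pos ⟨by simpa using hvG, hFi⟩, hfil, ← hFi, vertexSign]
      · rw [if_neg hF, if_neg, zero_mul]
        rintro ⟨h1, rfl⟩
        exact hF (Finset.erase_insert (by simpa using h1))
    · intro v _ hv
      rw [if_neg]
      rintro ⟨-, rfl⟩
      simp at hv
  rw [Finset.sum_congr rfl fun F _ => h F, Finset.sum_comm, chainBoundary,
    ← Finset.sum_subset (Finset.subset_univ Gᶜ)]
  · refine Finset.sum_congr rfl fun v hv => ?_
    rw [Finset.sum_eq_single (insert v G)]
    · rw [if_pos ⟨hv, rfl⟩]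
    · intro F _ hF
      rw [if_neg fun h => hF h.2]
    · simp
  · intro v _ hv
    exact Finset.sum_eq_zero fun F _ => if_neg fun h => hv h.1

lemma boundaryMap_apply_eq_chainBoundary (K : Type*) [Field K] {N : ℕ}
    (Δ : Finset (Finset (Fin N))) (m : ℕ) (f : {F // F ∈ cfaces Δ (m + 1)} → K)
    (g : Finset (Fin N) → K) (hg : ∀ F, g F = if h : F ∈ cfaces Δ (m + 1) then f ⟨F, h⟩ else 0)
    (G : {G // G ∈ cfaces Δ m}) : boundaryMap K Δ m f G = chainBoundary g G.1 := by
  rw [← sum_bcoeff_mul, ← Finset.sum_subset (Finset.subset_univ (cfaces Δ (m + 1))),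
    ← Finset.sum_coe_sort]
  · simp only [boundaryMap, LinearMap.pi_apply, LinearMap.sum_apply, LinearMap.smul_apply,
      LinearMap.proj_apply, smul_eq_mul]
    refine Finset.sum_congr rfl fun F _ => ?_
    rw [hg, dif_pos F.2]
  · intro F _ hF
    rw [hg, dif_neg hF, mul_zero]

lemma reducedHomologyRank_eq_zero {K : Type*} [Field K] {N : ℕ} {H : SimpleGraph (Fin N)}
    {W : Finset (Fin N)} {Δ : Finset (Finset (Fin N))}
    (hΔ : ∀ F, F ∈ Δ ↔ F ⊆ W ∧ ∀ u ∈ F, ∀ v ∈ F, ¬ H.Adj u v) (m : ℕ)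
    (h : IndepAcyclic K H W (m + 1)) : reducedHomologyRank K Δ (m : ℤ) = 0 := by
  classical
  have hface : ∀ c F, F ∈ cfaces Δ c ↔ IsIndepFace H W c F := by
    intro c F
    rw [cfaces, Finset.mem_filter, hΔ, IsIndepFace, and_assoc]
  rw [reducedHomologyRank, if_neg (by omega), if_pos (by omega), Int.toNat_natCast]
  suffices hle : LinearMap.ker (boundaryMap K Δ m) ≤
      LinearMap.range (boundaryMap K Δ (m + 1)) by
    have htop : Submodule.comap (LinearMap.ker (boundaryMap K Δ m)).subtype
        (LinearMap.range (boundaryMap K Δ (m + 1))) = ⊤ :=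
      Submodule.comap_subtype_eq_top.mpr hle
    rw [htop]
    exact Module.finrank_zero_of_subsingleton
  intro f hf
  rw [LinearMap.mem_ker] at hf
  set f' : Finset (Fin N) → K := fun F => if h : F ∈ cfaces Δ (m + 1) then f ⟨F, h⟩ else 0
    with hf'
  have hsupp : ∀ F, f' F ≠ 0 → IsIndepFace H W (m + 1) F := by
    intro F hF
    rw [← hface]
    by_contra hcon
    exact hF (dif_neg hcon)
  obtain ⟨g, hg, hdg⟩ := h f' hsupp (by
    intro G
    by_cases hG : G ∈ cfaces Δ m
    · rw [← boundaryMap_apply_eq_chainBoundary K Δ m f f' (fun _ => rfl) ⟨G, hG⟩, hf]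
      rfl
    · refine Finset.sum_eq_zero fun v hv => ?_
      by_contra hne
      obtain ⟨h1, h2, h3⟩ := hsupp _ (right_ne_zero_of_mul hne)
      rw [Finset.card_insert_of_notMem (by simpa using hv)] at h3
      exact hG ((hface m G).2 ⟨fun u hu => h1 (by simp [hu]),
        fun u hu w hw => h2 u (by simp [hu]) w (by simp [hw]), by omega⟩))
  refine ⟨fun F => g F.1, funext fun G => ?_⟩
  rw [boundaryMap_apply_eq_chainBoundary K Δ (m + 1) _ g _ G, hdg, hf']
  · simp only [dif_pos G.2]
  · intro F
    split_ifs with hF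
    · rfl
    · by_contra hne
      exact hF ((hface _ F).2 (hg F hne))

lemma regEdgeIdeal_le_of_homologyBound (K : Type*) [Field K] {V : Type*} [Fintype V]
    (G : SimpleGraph V) (φ : Fin (Fintype.card V) → ℕ) (r : ℕ)
    (h : HomologyBound K (G.comap (Fintype.equivFin V).symm) φ (fun _ => True) r) :
    regEdgeIdeal K G ≤ r + 1 := by
  classical
  refine csSup_le' ?_
  rintro d ⟨i, j, hb, hd⟩
  by_contra! hlt
  refine hb (Finset.sum_eq_zero fun W _ => ?_)
  obtain ⟨m, hm⟩ : ∃ m : ℕ, (j : ℤ) - i - 2 = m := ⟨d - 2, by omega⟩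
  rw [hm]
  refine reducedHomologyRank_eq_zero (H := G.comap (Fintype.equivFin V).symm) (W := W) ?_ m
    (h W (fun _ _ => trivial) m (by omega))
  intro F
  simp only [indComplex, Finset.mem_filter, Finset.mem_univ, true_and, SimpleGraph.comap_adj]
  exact and_comm

lemma circulant_adj_iff_ladderAdj {n : ℕ} [NeZero n] (hn : 4 ≤ n) (x y : ZMod (2 * n)) :
    (circulant (2 * n) {1, n}).Adj x y ↔ LadderAdj n x.val y.val := by
  have key : ∀ (x y : ZMod (2 * n)) (s : ℕ), y - x = (s : ZMod (2 * n)) ↔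
      y.val = (x.val + s) % (2 * n) := by
    intro x y s
    rw [sub_eq_iff_eq_add, add_comm, ← ZMod.val_natCast, Nat.cast_add, ZMod.natCast_zmod_val,
      (ZMod.val_injective (2 * n)).eq_iff]
  have hx := ZMod.val_lt x
  have hy := ZMod.val_lt y
  have hmod : ∀ a s, a < 2 * n → s ≤ n → (a + s) % (2 * n) =
      if a + s < 2 * n then a + s else a + s - 2 * n := by
    intro a s ha hs
    split_ifs with h
    · exact Nat.mod_eq_of_lt h
    · rw [Nat.mod_eq_sub_mod (by omega), Nat.mod_eq_of_lt (by omega)]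
  simp only [circulant, SimpleGraph.fromRel_adj, Set.mem_insert_iff, Set.mem_singleton_iff,
    exists_eq_or_imp, exists_eq_left, key, ne_eq, ← (ZMod.val_injective (2 * n)).eq_iff]
  rw [hmod _ _ hx (by omega), hmod _ _ hx le_rfl, hmod _ _ hy (by omega), hmod _ _ hy le_rfl]
  simp only [LadderAdj]
  split_ifs <;> omega

lemma regEdgeIdeal_circulant_le (K : Type*) [Field K] (n : ℕ) [NeZero n] (hn : 4 ≤ n) {r : ℕ}
    (hr₁ : n / 2 ≤ r + 1) (hr₂ : stripBound (n - 2) 1 ≤ r) :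
    regEdgeIdeal K (circulant (2 * n) {1, n}) ≤ r + 2 := by
  set e := (Fintype.equivFin (ZMod (2 * n))).symm
  refine regEdgeIdeal_le_of_homologyBound K _ (fun w => (e w).val) (r + 1) ?_
  refine homologyBound_ladder (n := n)
    (ψ := fun w => if (e w).val < n then (e w).val + n else (e w).val - n) ?_ ?_ ?_ ?_ hn hr₁ hr₂
  · exact (ZMod.val_injective _).comp e.injective
  · exact fun w => ZMod.val_lt _
  · intro v w
    rw [SimpleGraph.comap_adj]
    exact circulant_adj_iff_ladderAdj hn _ _
  · intro w
    split_ifs <;> omega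

/-- **Lemma 4.4(i).**
Let `n ≥ 4` and let `G = C_{2n}(1, n)` be the cubic circulant graph on `2n`
vertices with connection set `{1, n}`.  Then `reg(I(G)) ≤ k + 1` if `n = 2k`,
or if `n = 2k + 1` with `k` odd; and `reg(I(G)) ≤ k + 2` if `n = 2k + 1` with
`k` even. -/
theorem regularity_bound_C2n_1_n
    (K : Type*) [Field K] (n : ℕ) [NeZero n] (hn : 4 ≤ n) :
    (∀ k : ℕ, (n = 2 * k ∨ (n = 2 * k + 1 ∧ Odd k)) →
      regEdgeIdeal K (circulant (2 * n) {1, n}) ≤ k + 1) ∧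
    (∀ k : ℕ, n = 2 * k + 1 → Even k →
      regEdgeIdeal K (circulant (2 * n) {1, n}) ≤ k + 2) := by
  refine ⟨fun k hk => ?_, fun k hk hev => ?_⟩
  · obtain ⟨r, rfl⟩ : ∃ r, k = r + 1 := ⟨k - 1, by omega⟩
    refine regEdgeIdeal_circulant_le K n hn (by omega) ?_
    unfold stripBound
    simp only [Nat.odd_iff] at hk
    split_ifs <;> omega
  · refine regEdgeIdeal_circulant_le K n hn (by omega) ?_
    unfold stripBound
    rw [Nat.even_iff] at hev
    split_ifs <;> omega
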